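/- Let φ be a C^∞ function on ℝ with φ ≥ 0, supp(φ) ⊆ [−1,1], and ∫_ℝ φ(x) dx = 1. Let Q > 2, M > 2, δ = 1/Q, let P(Q) be the set of primes ≤ Q, and for θ = (θ_p)_{p∈P(Q)} put Φ_Q(θ) = ∏_{p≤Q} φ_δ(θ_p). Then there exist constants C, C₁ > 0 depending only on φ such that for every θ⁰ ∈ ℝ^{P(Q)} and θ ∈ ℝ^{P(Q)}: | Φ_Q(θ − θ⁰) − Σ_{n ∈ ℤ^{P(Q)}, max_p |n_p| ≤ M} β_n(θ⁰) exp(2πi ⟨n, θ⟩) | ≤ (C/M) exp(C₁ Q), where ⟨n,θ⟩ = Σ_{p ≤ Q} n_p θ_p and β_n(θ⁰) = ∏_{p ≤ Q} α_{n_p}(θ_p⁰). -/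

import Mathlib

open Complex MeasureTheory

attribute [local instance] Classical.propDecidable

noncomputable section

/-- The `1`-periodic mollifier at scale `δ`: on `[-1/2, 1/2]` it equals `θ ↦ (1/δ) φ(θ/δ)`,
and it is extended to `ℝ` with period `1` (here `θ - round θ ∈ [-1/2, 1/2)` is the
representative of `θ` modulo `1`). -/
def periodize (φ : ℝ → ℝ) (δ θ : ℝ) : ℝ := (1 / δ) * φ ((θ - round θ) / δ)

/-- The Fourier coefficients `α_n(θ₀) = ∫_{-1/2}^{1/2} φ_δ(θ - θ₀) e^{-2πinθ} dθ` of the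
translated periodic mollifier. -/
def mollCoeff (φ : ℝ → ℝ) (δ θ₀ : ℝ) (n : ℤ) : ℂ :=
  ∫ θ in (-(1 / 2) : ℝ)..(1 / 2 : ℝ),
    (periodize φ δ (θ - θ₀) : ℂ) * Complex.exp (-(2 * (Real.pi : ℂ) * Complex.I * (n : ℂ) * (θ : ℂ)))

/-- the finite set of primes `p ≤ Q` -/
def primesLE (Q : ℝ) : Finset ℕ :=
  (Finset.range (Nat.floor Q + 1)).filter Nat.Prime


lemma aux_card (Q : ℝ) (hQ : 2 < Q) :
    ((primesLE Q).card : ℝ) * Real.log Q ≤ (2 * Real.log 4 + 2) * Q ∧ ((primesLE Q).card : ℝ) ≤ Q := by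
  have hc : (primesLE Q).card = Nat.primeCounting ⌊Q⌋₊ := by
    rw [primesLE, Nat.primeCounting, Nat.primeCounting', Nat.count_eq_card_filter_range]
  constructor
  · rw [hc]
    have hl : 0 < Real.log √Q := Real.log_pos (by
      rw [Real.lt_sqrt (by norm_num)]; linarith)
    have h := mul_le_mul_of_nonneg_right (Chebyshev.pi_le_log4_mul_div (x := Q) (by linarith)) hl.le
    rw [add_mul, div_mul_cancel₀ _ hl.ne'] at h
    have h1 : Real.log √Q = Real.log Q / 2 := Real.log_sqrt (by linarith)
    have h2 : Real.log √Q ≤ √Q := (Real.log_le_self (Real.sqrt_nonneg _))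
    have h3 : √Q * √Q = Q := Real.mul_self_sqrt (by linarith)
    have h4 := mul_le_mul_of_nonneg_left h2 (Real.sqrt_nonneg Q)
    have h5 : (Nat.primeCounting ⌊Q⌋₊ : ℝ) * Real.log Q =
      2 * ((Nat.primeCounting ⌊Q⌋₊ : ℝ) * Real.log √Q) := by rw [h1]; ring
    rw [h5]; nlinarith
  · have hsub : primesLE Q ⊆ Finset.Icc 1 ⌊Q⌋₊ := by
      intro p hp
      rw [primesLE, Finset.mem_filter, Finset.mem_range] at hp
      rw [Finset.mem_Icc]
      exact ⟨hp.2.one_lt.le, by omega⟩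
    have hle := Finset.card_le_card hsub
    rw [Nat.card_Icc, Nat.add_sub_cancel] at hle
    calc ((primesLE Q).card : ℝ) ≤ (⌊Q⌋₊ : ℝ) := by exact_mod_cast hle
      _ ≤ Q := Nat.floor_le (by linarith)

lemma aux_prod {ι : Type*} (s : Finset ι) (a b : ι → ℂ) (A ε : ℝ) (hA : 1 ≤ A) (hε : 0 ≤ ε)
    (ha : ∀ i, ‖a i‖ ≤ A) (hb : ∀ i, ‖b i‖ ≤ A) (hab : ∀ i, ‖a i - b i‖ ≤ ε) :
    ‖∏ i ∈ s, a i - ∏ i ∈ s, b i‖ ≤ s.card * ε * A ^ s.card := by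
  classical
  induction s using Finset.induction_on with
  | empty => simp
  | insert i s hi ih =>
    rw [Finset.prod_insert hi, Finset.prod_insert hi, Finset.card_insert_of_notMem hi]
    have e : a i * ∏ j ∈ s, a j - b i * ∏ j ∈ s, b j =
      (a i - b i) * ∏ j ∈ s, a j + b i * (∏ j ∈ s, a j - ∏ j ∈ s, b j) := by ring
    have hp : ‖∏ j ∈ s, a j‖ ≤ A ^ s.card := by
      rw [norm_prod]; 
      calc ∏ j ∈ s, ‖a j‖ ≤ ∏ _j ∈ s, A :=
            Finset.prod_le_prod (fun j _ => norm_nonneg _) (fun j _ => ha j)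
        _ = A ^ s.card := by rw [Finset.prod_const]
    rw [e]
    have hAp : 0 ≤ A ^ s.card := by positivity
    calc _ ≤ ‖a i - b i‖ * ‖∏ j ∈ s, a j‖ + ‖b i‖ * ‖∏ j ∈ s, a j - ∏ j ∈ s, b j‖ := by
          refine (norm_add_le _ _).trans ?_
          rw [norm_mul, norm_mul]
      _ ≤ ε * A ^ s.card + A * (s.card * ε * A ^ s.card) := by
          gcongr
          · exact hab i
          · exact hb i
      _ ≤ _ := by
          push_cast
          rw [pow_succ]
          nlinarith [mul_nonneg hε hAp]

/-- the scaled function -/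
def scaled (φ : ℝ → ℝ) (Q x : ℝ) : ℂ := ((Q * φ (Q * x) : ℝ) : ℂ)

lemma scaled_zero (φ : ℝ → ℝ) (hφsupp : Function.support φ ⊆ Set.Icc (-1) 1) (Q x : ℝ) (hQ : 2 < Q)
    (hx : 1 / 2 ≤ |x|) : scaled φ Q x = 0 := by
  have : φ (Q * x) = 0 := by
    by_contra h
    have h1 := abs_le.2 (hφsupp h)
    rw [abs_mul, abs_of_pos (by linarith)] at h1
    nlinarith
  simp [scaled, this]

lemma periodize_eq (φ : ℝ → ℝ) (Q x : ℝ) :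
    (periodize φ (1 / Q) x : ℂ) = scaled φ Q (x - round x) := by
  simp only [periodize, scaled]
  congr 2
  · simp
  · congr 1; rw [div_div_eq_mul_div]; ring

lemma periodize_periodic (φ : ℝ → ℝ) (δ : ℝ) : Function.Periodic (periodize φ δ) 1 := by
  intro x
  simp [periodize, round_add_one]

lemma tsum_scaled (φ : ℝ → ℝ) (hφsupp : Function.support φ ⊆ Set.Icc (-1) 1) (Q x : ℝ) (hQ : 2 < Q) :
    ∑' n : ℤ, scaled φ Q (x + n) = (periodize φ (1 / Q) x : ℂ) := by
  rw [periodize_eq, tsum_eq_single (-round x)]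
  · push_cast; rw [sub_eq_add_neg]
  · intro n hn
    apply scaled_zero φ hφsupp Q _ hQ
    by_contra! h
    apply hn
    have h1 := abs_sub_round x
    have : |((n + round x : ℤ) : ℝ)| < 1 := by
      have e : ((n + round x : ℤ) : ℝ) = (x + n) - (x - round x) := by push_cast; ring
      rw [e]
      exact (abs_sub _ _).trans_lt (by linarith)
    have h2 : |n + round x| < 1 := by exact_mod_cast this
    have := Int.abs_lt_one_iff.1 h2
    omega

open scoped FourierTransform

lemma fourier_scaled (φ : ℝ → ℝ) (Q w : ℝ) (hQ : 2 < Q) :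
    𝓕 (scaled φ Q) w = 𝓕 (fun x => (φ x : ℂ)) (w / Q) := by
  rw [Real.fourier_real_eq_integral_exp_smul, Real.fourier_real_eq_integral_exp_smul]
  have h := Measure.integral_comp_mul_left
    (fun v : ℝ => Complex.exp (↑(-2 * Real.pi * v * (w / Q)) * Complex.I) • (φ v : ℂ)) Q
  have hQ0 : Q ≠ 0 := by linarith
  have hQ0' : (Q : ℂ) ≠ 0 := by exact_mod_cast hQ0
  rw [abs_of_pos (by positivity)] at h
  have h2 : ∫ v : ℝ, Complex.exp (↑(-2 * Real.pi * v * w) * Complex.I) • scaled φ Q v =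
     (Q : ℂ) * ∫ x : ℝ, Complex.exp (↑(-2 * Real.pi * (Q * x) * (w / Q)) * Complex.I) • (φ (Q * x) : ℂ) := by
    rw [← integral_const_mul]
    congr 1; ext v
    have : -2 * Real.pi * (Q * v) * (w / Q) = -2 * Real.pi * v * w := by field_simp
    rw [this]
    simp only [scaled, smul_eq_mul]; push_cast; ring
  rw [h2, h, Complex.real_smul]
  push_cast
  rw [← mul_assoc, mul_inv_cancel₀ hQ0', one_mul]

lemma mollCoeff_eq (φ : ℝ → ℝ) (hφsupp : Function.support φ ⊆ Set.Icc (-1) 1) (Q θ₀ : ℝ) (hQ : 2 < Q)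
    (n : ℤ) : mollCoeff φ (1 / Q) θ₀ n =
      𝓕 (scaled φ Q) n * Complex.exp (-(2 * (Real.pi : ℂ) * Complex.I * (n : ℂ) * (θ₀ : ℂ))) := by
  set F : ℝ → ℂ := fun θ => (periodize φ (1 / Q) θ : ℂ) *
    Complex.exp (-(2 * (Real.pi : ℂ) * Complex.I * (n : ℂ) * (θ : ℂ))) with hF
  have hper : Function.Periodic F 1 := by
    intro x
    simp only [hF]
    rw [periodize_periodic]
    congr 1
    rw [Complex.exp_eq_exp_iff_exists_int]
    exact ⟨-n, by push_cast; ring⟩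
  have h1 : mollCoeff φ (1 / Q) θ₀ n = (∫ θ in (-(1 / 2) : ℝ)..(1 / 2 : ℝ), F (θ - θ₀)) *
      Complex.exp (-(2 * (Real.pi : ℂ) * Complex.I * (n : ℂ) * (θ₀ : ℂ))) := by
    rw [mollCoeff, ← intervalIntegral.integral_mul_const]
    congr 1; ext θ
    simp only [hF]
    rw [mul_assoc (periodize φ (1 / Q) (θ - θ₀) : ℂ), ← Complex.exp_add]
    congr 2; push_cast; ring
  rw [h1]
  congr 1
  rw [intervalIntegral.integral_comp_sub_right]
  have h2 := hper.intervalIntegral_add_eq (-(1/2) - θ₀) (-(1/2))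
  have e1 : (-(1/2) - θ₀ + 1 : ℝ) = 1/2 - θ₀ := by ring
  have e2 : (-(1/2) + 1 : ℝ) = 1/2 := by ring
  rw [e1, e2] at h2
  rw [h2, Real.fourier_real_eq_integral_exp_smul, intervalIntegral.integral_of_le (by norm_num),
    integral_Ioc_eq_integral_Ioo]
  rw [← setIntegral_eq_integral_of_forall_compl_eq_zero (s := Set.Ioo (-(1/2) : ℝ) (1/2))
    (f := fun v : ℝ => Complex.exp (↑(-2 * Real.pi * v * n) * Complex.I) • scaled φ Q v)]
  · apply setIntegral_congr_fun measurableSet_Ioo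
    intro x hx
    have hr : round x = 0 := by
      rw [round_eq_zero_iff]; exact ⟨hx.1.le, hx.2⟩
    simp only [hF]
    rw [periodize_eq, hr, smul_eq_mul, mul_comm]
    congr 2
    · push_cast; ring
    · simp
  · intro x hx
    rw [scaled_zero φ hφsupp Q x hQ, smul_zero]
    by_contra! h
    exact hx ⟨(abs_lt.1 h).1, (abs_lt.1 h).2⟩

lemma aux_one (φ : ℝ → ℝ) (hφ : ContDiff ℝ (⊤ : ℕ∞) φ)
    (hφsupp : Function.support φ ⊆ Set.Icc (-1) 1) :
    ∃ K : ℝ, 1 ≤ K ∧ ∀ Q M : ℝ, 2 < Q → 2 < M → ∀ θ₀ θ : ℝ,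
      ‖(periodize φ (1 / Q) (θ - θ₀) : ℂ)‖ ≤ K * Q ^ 3 ∧
      ‖(periodize φ (1 / Q) (θ - θ₀) : ℂ) - ∑ n ∈ Finset.Icc (-⌊M⌋) ⌊M⌋,
        mollCoeff φ (1 / Q) θ₀ n * Complex.exp (2 * (Real.pi : ℂ) * Complex.I * ((n : ℂ) * (θ : ℂ)))‖
        ≤ K * Q ^ 3 / M := by
  have hcs : HasCompactSupport φ := HasCompactSupport.intro isCompact_Icc
    (fun x hx => by by_contra h; exact hx (hφsupp h))
  obtain ⟨B, hB⟩ := hcs.exists_bound_of_continuous hφ.continuous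
  have hsm : ∀ Q : ℝ, ContDiff ℝ (⊤ : ℕ∞) (scaled φ Q) := fun Q =>
    Complex.ofRealCLM.contDiff.comp (contDiff_const.mul (hφ.comp (contDiff_const.mul contDiff_id)))
  have hsc : ∀ Q : ℝ, 2 < Q → HasCompactSupport (scaled φ Q) := fun Q hQ =>
    HasCompactSupport.intro (isCompact_Icc (a := (-(1/2) : ℝ)) (b := 1/2))
    (fun x hx => by
      apply scaled_zero φ hφsupp Q x hQ
      by_contra! h
      exact hx (abs_le.1 h.le))
  have hcs1 : HasCompactSupport (fun x => (φ x : ℂ)) := hcs.comp_left (g := fun x : ℝ => (x : ℂ)) (by simp)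
  obtain ⟨K₀, hK₀, hdec⟩ := (𝓕 (hcs1.toSchwartzMap (Complex.ofRealCLM.contDiff.comp hφ))).decay 3 0
  have hdec' : ∀ Q : ℝ, 2 < Q → ∀ n : ℤ, |(n : ℝ)| ^ 3 * ‖𝓕 (scaled φ Q) n‖ ≤ K₀ * Q ^ 3 := by
    intro Q hQ n
    have h := hdec (n / Q)
    rw [norm_iteratedFDeriv_zero, SchwartzMap.fourier_coe] at h
    have e : ((hcs1.toSchwartzMap (Complex.ofRealCLM.contDiff.comp hφ) : SchwartzMap ℝ ℂ) : ℝ → ℂ) =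
      fun x => (φ x : ℂ) := rfl
    rw [e, ← fourier_scaled φ Q _ hQ, norm_div, Real.norm_eq_abs, Real.norm_eq_abs,
      abs_of_pos (a := Q) (by linarith), div_pow, div_mul_eq_mul_div,
      div_le_iff₀ (by positivity)] at h
    exact h
  have hS : Summable (fun n : ℤ => 1 / (n : ℝ) ^ 2) := Real.summable_one_div_int_pow.2 (by norm_num)
  set S := ∑' n : ℤ, 1 / (n : ℝ) ^ 2 with hSdef
  have hS0 : 0 ≤ S := tsum_nonneg (fun n => by positivity)
  refine ⟨1 + |B| + K₀ * S, by nlinarith [abs_nonneg B, mul_nonneg hK₀.le hS0], ?_⟩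
  intro Q M hQ hM θ₀ θ
  have hQ3 : Q ≤ Q ^ 3 := by nlinarith [sq_nonneg Q]
  constructor
  · rw [periodize_eq, scaled, Complex.norm_real, norm_mul, Real.norm_eq_abs,
      abs_of_pos (a := Q) (by linarith)]
    calc _ ≤ Q * |B| := by
          gcongr
          exact (hB _).trans (le_abs_self _)
      _ ≤ Q ^ 3 * |B| := by gcongr
      _ ≤ _ := by
        have : 0 ≤ Q ^ 3 := by positivity
        nlinarith [mul_nonneg hK₀.le hS0, mul_nonneg (mul_nonneg hK₀.le hS0) this]
  · have hP := ((hsc Q hQ).toSchwartzMap (hsm Q)).tsum_eq_tsum_fourier (θ - θ₀)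
    rw [SchwartzMap.fourier_coe] at hP
    have e : (((hsc Q hQ).toSchwartzMap (hsm Q) : SchwartzMap ℝ ℂ) : ℝ → ℂ) = scaled φ Q := rfl
    rw [e, tsum_scaled φ hφsupp Q _ hQ] at hP
    have hterm : ∀ n : ℤ, 𝓕 (scaled φ Q) n * fourier n ((θ - θ₀ : ℝ) : UnitAddCircle) =
        mollCoeff φ (1 / Q) θ₀ n *
          Complex.exp (2 * (Real.pi : ℂ) * Complex.I * ((n : ℂ) * (θ : ℂ))) := by
      intro n
      rw [mollCoeff_eq φ hφsupp Q θ₀ hQ, fourier_coe_apply,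
        mul_assoc (𝓕 (scaled φ Q) n), ← Complex.exp_add]
      congr 2; push_cast; ring
    simp_rw [hterm] at hP
    set T : ℤ → ℂ := fun n => mollCoeff φ (1 / Q) θ₀ n *
          Complex.exp (2 * (Real.pi : ℂ) * Complex.I * ((n : ℂ) * (θ : ℂ))) with hT
    have hnorm : ∀ n : ℤ, ‖T n‖ = ‖𝓕 (scaled φ Q) n‖ := by
      intro n
      rw [hT]; dsimp only
      rw [← hterm, norm_mul, fourier_apply, Circle.norm_coe, mul_one]
    have hb3 : ∀ n : ℤ, |(n : ℝ)| ^ 3 * ‖T n‖ ≤ K₀ * Q ^ 3 := fun n => by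
      rw [hnorm]; exact hdec' Q hQ n
    have key : ∀ n : ℤ, ∀ L : ℝ, 0 < L → L ≤ |(n : ℝ)| → ‖T n‖ ≤ K₀ * Q ^ 3 / L * (1 / (n : ℝ) ^ 2) := by
      intro n L hL hn
      have h1 := hb3 n
      have hn0 : 0 < |(n : ℝ)| := by linarith
      rw [← sq_abs, div_mul_div_comm, mul_one, le_div_iff₀ (by positivity)]
      calc ‖T n‖ * (L * |(n : ℝ)| ^ 2) ≤ ‖T n‖ * (|(n : ℝ)| * |(n : ℝ)| ^ 2) := by gcongr
        _ = |(n : ℝ)| ^ 3 * ‖T n‖ := by ring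
        _ ≤ _ := h1
    have hsum : Summable T := by
      refine Summable.of_norm_bounded_eventually (g := fun n : ℤ => K₀ * Q ^ 3 / 1 * (1 / (n : ℝ) ^ 2))
        (hS.mul_left _) ?_
      filter_upwards [(Set.finite_singleton (0 : ℤ)).compl_mem_cofinite] with n hn
      apply key n 1 one_pos
      have : 1 ≤ |n| := Int.one_le_abs hn
      exact_mod_cast this
    rw [hP, ← hsum.sum_add_tsum_compl (s := Finset.Icc (-⌊M⌋) ⌊M⌋), add_sub_cancel_left]
    have hS' : Summable (fun n : ℤ => K₀ * Q ^ 3 / M * (1 / (n : ℝ) ^ 2)) := hS.mul_left _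
    have hle : ‖∑' n : ((Finset.Icc (-⌊M⌋) ⌊M⌋ : Finset ℤ) : Set ℤ)ᶜ.Elem, T n‖ ≤
        ∑' n : ((Finset.Icc (-⌊M⌋) ⌊M⌋ : Finset ℤ) : Set ℤ)ᶜ.Elem,
          K₀ * Q ^ 3 / M * (1 / ((n : ℤ) : ℝ) ^ 2) := by
      apply tsum_of_norm_bounded (hS'.subtype _).hasSum
      rintro ⟨n, hn⟩
      apply key n M (by linarith)
      by_contra! h
      apply hn
      have h1 : |n| ≤ ⌊M⌋ := Int.le_floor.2 (by push_cast; exact h.le)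
      simpa [Finset.mem_Icc] using abs_le.1 h1
    refine hle.trans ?_
    have h3 : ∑' n : ((Finset.Icc (-⌊M⌋) ⌊M⌋ : Finset ℤ) : Set ℤ)ᶜ.Elem,
          K₀ * Q ^ 3 / M * (1 / ((n : ℤ) : ℝ) ^ 2) ≤ ∑' n : ℤ, K₀ * Q ^ 3 / M * (1 / (n : ℝ) ^ 2) :=
      hS'.tsum_subtype_le _ _ (fun n => by positivity)
    refine h3.trans ?_
    rw [tsum_mul_left, ← hSdef, div_mul_eq_mul_div]
    apply div_le_div_of_nonneg_right _ (by linarith)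
    have : 0 ≤ Q ^ 3 := by positivity
    nlinarith [mul_nonneg (abs_nonneg B) this]

/-- **The truncated Fourier expansion (2.4) of the mollifier `Φ_Q`.**
`|Φ_Q(θ - θ⁰) - ∑_{max_p |n_p| ≤ M} β_n(θ⁰) e^{2πi⟨n,θ⟩}| ≤ (C/M) exp (C₁ Q)`. -/
theorem mollifier_truncated_fourier_expansion
    (φ : ℝ → ℝ) (hφ : ContDiff ℝ (⊤ : ℕ∞) φ) (hφ0 : ∀ x, 0 ≤ φ x)
    (hφsupp : Function.support φ ⊆ Set.Icc (-1) 1) (hφint : ∫ x, φ x = 1) :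
    ∃ C C₁ : ℝ, 0 < C ∧ 0 < C₁ ∧
      ∀ Q M : ℝ, 2 < Q → 2 < M →
        ∀ θ₀ θ : {p // p ∈ primesLE Q} → ℝ,
          ‖(∏ p : {p // p ∈ primesLE Q}, (periodize φ (1 / Q) (θ p - θ₀ p) : ℂ)) -
              ∑' n : {p // p ∈ primesLE Q} → ℤ,
                (if ∀ p, |(n p : ℝ)| ≤ M then
                  (∏ p, mollCoeff φ (1 / Q) (θ₀ p) (n p)) *
                    Complex.exp (2 * (Real.pi : ℂ) * Complex.I * ∑ p, (n p : ℂ) * (θ p : ℂ))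
                 else 0)‖ ≤ C / M * Real.exp (C₁ * Q) := by
  obtain ⟨K, hK, hone⟩ := aux_one φ hφ hφsupp
  have hlK : 0 ≤ Real.log K := Real.log_nonneg hK
  refine ⟨1, 1 + 4 * Real.log (2 * K) + 3 * (2 * Real.log 4 + 2) + 6, one_pos, ?_, ?_⟩
  · have := Real.log_nonneg (x := 2 * K) (by linarith)
    have := Real.log_nonneg (x := 4) (by norm_num)
    linarith
  intro Q M hQ hM θ₀ θ
  set k := (primesLE Q).card with hk
  obtain ⟨hc1, hc2⟩ := aux_card Q hQ
  rw [← hk] at hc1 hc2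
  set T : {p // p ∈ primesLE Q} → ℤ → ℂ := fun p n => mollCoeff φ (1 / Q) (θ₀ p) n *
    Complex.exp (2 * (Real.pi : ℂ) * Complex.I * ((n : ℂ) * (θ p : ℂ))) with hT
  have hts : (∑' n : {p // p ∈ primesLE Q} → ℤ,
                (if ∀ p, |(n p : ℝ)| ≤ M then
                  (∏ p, mollCoeff φ (1 / Q) (θ₀ p) (n p)) *
                    Complex.exp (2 * (Real.pi : ℂ) * Complex.I * ∑ p, (n p : ℂ) * (θ p : ℂ))
                 else 0)) = ∏ p, ∑ n ∈ Finset.Icc (-⌊M⌋) ⌊M⌋, T p n := by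
    have hmem : ∀ n : {p // p ∈ primesLE Q} → ℤ,
        n ∈ Fintype.piFinset (fun _ : {p // p ∈ primesLE Q} => Finset.Icc (-⌊M⌋) ⌊M⌋) ↔
          ∀ p, |(n p : ℝ)| ≤ M := by
      intro n
      rw [Fintype.mem_piFinset]
      refine forall_congr' fun p => ?_
      rw [Finset.mem_Icc, ← abs_le, Int.le_floor]
      push_cast; rfl
    rw [Finset.prod_univ_sum, tsum_eq_sum
      (s := Fintype.piFinset (fun _ : {p // p ∈ primesLE Q} => Finset.Icc (-⌊M⌋) ⌊M⌋))]
    · apply Finset.sum_congr rfl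
      intro n hn
      rw [if_pos ((hmem n).1 hn), Finset.mul_sum, Complex.exp_sum, ← Finset.prod_mul_distrib]
    · intro n hn
      rw [if_neg (fun h => hn ((hmem n).2 h))]
  rw [hts]
  set A := 2 * K * Q ^ 3 with hA
  have hQ3 : Q ≤ Q ^ 3 := by nlinarith [sq_nonneg Q]
  have hKQ : Q ^ 3 ≤ K * Q ^ 3 := le_mul_of_one_le_left (by positivity) hK
  have hA1 : Q ≤ A := by rw [hA]; nlinarith
  have hA0 : 0 < A := by linarith
  have hM0 : 0 < M := by linarith
  have hKM : K * Q ^ 3 / M ≤ K * Q ^ 3 := div_le_self (by positivity) (by linarith)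
  have hmain := aux_prod Finset.univ (fun p => (periodize φ (1 / Q) (θ p - θ₀ p) : ℂ))
    (fun p => ∑ n ∈ Finset.Icc (-⌊M⌋) ⌊M⌋, T p n) A (A / M) (by linarith) (by positivity)
    (fun p => (hone Q M hQ hM (θ₀ p) (θ p)).1.trans (by rw [hA]; nlinarith))
    (fun p => by
      obtain ⟨h1, h2⟩ := hone Q M hQ hM (θ₀ p) (θ p)
      have := norm_le_norm_add_norm_sub (periodize φ (1 / Q) (θ p - θ₀ p) : ℂ)
        (∑ n ∈ Finset.Icc (-⌊M⌋) ⌊M⌋, T p n)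
      have h3 := h2.trans hKM
      simp only [hT] at this ⊢
      rw [hA]; linarith)
    (fun p => (hone Q M hQ hM (θ₀ p) (θ p)).2.trans (by
      rw [hA]; gcongr; linarith))
  refine hmain.trans ?_
  have hcard : (Finset.univ : Finset {p // p ∈ primesLE Q}).card = k := by
    rw [Finset.card_univ, Fintype.card_coe]
  rw [hcard]
  have hlogA : Real.log A = Real.log (2 * K) + 3 * Real.log Q := by
    rw [hA, Real.log_mul (by positivity) (by positivity), Real.log_pow]; norm_num
  have hl2K : 0 ≤ Real.log (2 * K) := Real.log_nonneg (by linarith)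
  have hlQ : Real.log Q ≤ Q := Real.log_le_self (by linarith)
  have h4 : 0 ≤ Real.log 4 := Real.log_nonneg (by norm_num)
  calc (k : ℝ) * (A / M) * A ^ k ≤ A * (A / M) * A ^ k := by gcongr; linarith
    _ = 1 / M * A ^ (k + 2) := by ring
    _ ≤ _ := by
      gcongr
      rw [← Real.exp_log (pow_pos hA0 _), Real.exp_le_exp, Real.log_pow, hlogA]
      push_cast
      nlinarith [mul_le_mul_of_nonneg_right hc2 hl2K, mul_nonneg hl2K (by linarith : 0 ≤ Q - 2)]

end
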